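/- Fix a player i and the strategies s_{-i} of all other players. For every node v ∈ V, the function s_i ↦ g^i_v(s_i, s_{-i}) is monotone nondecreasing: for all sets X ⊆ Y ⊆ V, g^i_v(X, s_{-i}) ≤ g^i_v(Y, s_{-i}). -/

import Mathlib

open Finset

/-- `seedCount s u` is `m_u(s)`, the number of players that include node `u`
in their seed set. -/
def seedCount {m n : ℕ} (s : Fin m → Finset (Fin n)) (u : Fin n) : ℕ :=
  (Finset.univ.filter (fun j => u ∈ s j)).card

/-- `seeded s` is `V_s`, the set of nodes seeded by at least one player. -/
def seeded {m n : ℕ} (s : Fin m → Finset (Fin n)) : Finset (Fin n) :=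
  Finset.univ.biUnion s

/-- `fPart c ε s i v` is `f^i_v(s) = Σ_{u ∈ s_i} c^u_v / m_u(s) + Σ_{u ∈ V ∖ V_s} ε·c^u_v`. -/
noncomputable def fPart {m n : ℕ} (c : Fin n → Fin n → ℝ) (ε : ℝ) (s : Fin m → Finset (Fin n))
    (i : Fin m) (v : Fin n) : ℝ :=
  (∑ u ∈ s i, c u v / (seedCount s u : ℝ)) + ∑ u ∈ Finset.univ \ seeded s, ε * c u v

/-- `fTot c ε s v` is `f_v(s) = Σ_{j ∈ M} f^j_v(s)`. -/
noncomputable def fTot {m n : ℕ} (c : Fin n → Fin n → ℝ) (ε : ℝ) (s : Fin m → Finset (Fin n))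
    (v : Fin n) : ℝ :=
  ∑ j : Fin m, fPart c ε s j v

/-- `gPart c ε s i v` is `g^i_v(s) = f^i_v(s) / f_v(s)`. -/
noncomputable def gPart {m n : ℕ} (c : Fin n → Fin n → ℝ) (ε : ℝ) (s : Fin m → Finset (Fin n))
    (i : Fin m) (v : Fin n) : ℝ :=
  fPart c ε s i v / fTot c ε s v

/-- `payoff c ε s i` is the utility `π_i(s) = (1/n) Σ_{v ∈ V} g^i_v(s)`. -/
noncomputable def payoff {m n : ℕ} (c : Fin n → Fin n → ℝ) (ε : ℝ) (s : Fin m → Finset (Fin n))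
    (i : Fin m) : ℝ :=
  (1 / (n : ℝ)) * ∑ v : Fin n, gPart c ε s i v

/-- The coefficient of `c u v` in `fPart c ε s i v`. -/
noncomputable def nodeShare {m n : ℕ} (ε : ℝ) (s : Fin m → Finset (Fin n)) (i : Fin m)
    (u : Fin n) : ℝ :=
  if u ∈ s i then 1 / (seedCount s u : ℝ) else if seedCount s u = 0 then ε else 0

lemma seedCount_eq_zero_iff {m n : ℕ} {s : Fin m → Finset (Fin n)} {u : Fin n} :
    seedCount s u = 0 ↔ ∀ j, u ∉ s j := by
  simp [seedCount, Finset.filter_eq_empty_iff]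

lemma seedCount_mono {m n : ℕ} {s t : Fin m → Finset (Fin n)} {u : Fin n}
    (h : ∀ j, u ∈ s j → u ∈ t j) : seedCount s u ≤ seedCount t u :=
  Finset.card_le_card (Finset.monotone_filter_right _ fun j _ => h j)

lemma seedCount_pos {m n : ℕ} {s : Fin m → Finset (Fin n)} {i : Fin m} {u : Fin n}
    (h : u ∈ s i) : 0 < seedCount s u :=
  Nat.pos_of_ne_zero fun h0 => seedCount_eq_zero_iff.1 h0 i h

lemma fPart_eq_sum_nodeShare {m n : ℕ} (c : Fin n → Fin n → ℝ) (ε : ℝ)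
    (s : Fin m → Finset (Fin n)) (i : Fin m) (v : Fin n) :
    fPart c ε s i v = ∑ u, c u v * nodeShare ε s i u := by
  have hunseeded : Finset.univ \ seeded s = Finset.univ.filter (fun u => seedCount s u = 0) := by
    ext u
    simp [seeded, seedCount_eq_zero_iff]
  have hown : ∑ u ∈ s i, c u v / (seedCount s u : ℝ) =
      ∑ u, if u ∈ s i then c u v / (seedCount s u : ℝ) else 0 := by simp
  rw [fPart, hunseeded, Finset.sum_filter, hown, ← Finset.sum_add_distrib]
  refine Finset.sum_congr rfl fun u _ => ?_
  by_cases hu : u ∈ s i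
  · simp [nodeShare, hu, (seedCount_pos hu).ne', div_eq_mul_inv]
  · simp [nodeShare, hu, mul_comm]

lemma nodeShare_nonneg {m n : ℕ} {ε : ℝ} (hε : 0 ≤ ε) (s : Fin m → Finset (Fin n)) (i : Fin m)
    (u : Fin n) : 0 ≤ nodeShare ε s i u := by
  unfold nodeShare
  split_ifs <;> positivity

lemma fPart_nonneg {m n : ℕ} {c : Fin n → Fin n → ℝ} (hc : ∀ u v, 0 ≤ c u v) {ε : ℝ}
    (hε : 0 ≤ ε) (s : Fin m → Finset (Fin n)) (i : Fin m) (v : Fin n) : 0 ≤ fPart c ε s i v := by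
  rw [fPart_eq_sum_nodeShare]
  exact Finset.sum_nonneg fun u _ => mul_nonneg (hc u v) (nodeShare_nonneg hε s i u)

/-- Some player has a positive share of every node. -/
lemma exists_nodeShare_pos {m n : ℕ} {ε : ℝ} (hε : 0 < ε) (s : Fin m → Finset (Fin n))
    (i : Fin m) (u : Fin n) : ∃ j, 0 < nodeShare ε s j u := by
  by_cases h : ∃ j, u ∈ s j
  · obtain ⟨j, hj⟩ := h
    have := seedCount_pos hj
    refine ⟨j, ?_⟩
    rw [nodeShare, if_pos hj]
    positivity
  · push Not at h
    exact ⟨i, by rwa [nodeShare, if_neg (h i), if_pos (seedCount_eq_zero_iff.2 h)]⟩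

lemma fTot_pos {m n : ℕ} {c : Fin n → Fin n → ℝ} (hc : ∀ u v, 0 ≤ c u v) {ε : ℝ} (hε : 0 < ε)
    (s : Fin m → Finset (Fin n)) (i : Fin m) {v : Fin n} (hv : 0 < ∑ u, c u v) :
    0 < fTot c ε s v := by
  obtain ⟨u, -, hu⟩ : ∃ u ∈ Finset.univ, 0 < c u v :=
    Finset.exists_lt_of_sum_lt (by simpa using hv)
  obtain ⟨j, hj⟩ := exists_nodeShare_pos hε s i u
  refine Finset.sum_pos' (fun k _ => fPart_nonneg hc hε.le s k v) ⟨j, Finset.mem_univ j, ?_⟩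
  rw [fPart_eq_sum_nodeShare]
  exact Finset.sum_pos' (fun w _ => mul_nonneg (hc w v) (nodeShare_nonneg hε.le s j w))
    ⟨u, Finset.mem_univ u, mul_pos hu hj⟩

/-- A player's share of a node grows with the player's own seed set. -/
lemma nodeShare_le_of_subset {m n : ℕ} {ε : ℝ} (hε' : ε ≤ 1)
    {s t : Fin m → Finset (Fin n)} {i : Fin m} (hi : s i ⊆ t i) (hne : ∀ j, j ≠ i → s j = t j)
    (u : Fin n) : nodeShare ε s i u ≤ nodeShare ε t i u := by
  by_cases hu : u ∈ s i ↔ u ∈ t i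
  · have hcount : seedCount s u = seedCount t u := by
      have hmem : ∀ j, u ∈ s j ↔ u ∈ t j := fun j => by
        rcases eq_or_ne j i with rfl | hj
        · exact hu
        · rw [hne j hj]
      simp only [seedCount, hmem]
    simp only [nodeShare, hu, hcount, le_refl]
  · have hs : u ∉ s i := fun h => hu ⟨fun _ => hi h, fun _ => h⟩
    have ht : u ∈ t i := by tauto
    rw [nodeShare, nodeShare, if_neg hs, if_pos ht]
    split_ifs with h0
    · have hone : seedCount t u = 1 := by
        refine Finset.card_eq_one.2 ⟨i, ?_⟩
        ext j
        rcases eq_or_ne j i with rfl | hj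
        · simp [ht]
        · simp [hj, ← hne j hj, seedCount_eq_zero_iff.1 h0 j]
      simpa [hone] using hε'
    · positivity

/-- A player's share of a node shrinks when the other players enlarge their seed sets. -/
lemma nodeShare_le_of_eq_of_subset {m n : ℕ} {ε : ℝ} (hε : 0 ≤ ε)
    {s t : Fin m → Finset (Fin n)} {j : Fin m} (hj : s j = t j) (hst : ∀ k, s k ⊆ t k)
    (u : Fin n) : nodeShare ε t j u ≤ nodeShare ε s j u := by
  have hcount : seedCount s u ≤ seedCount t u := seedCount_mono fun k hk => hst k hk
  by_cases hu : u ∈ s j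
  · have hpos : (0 : ℝ) < seedCount s u := Nat.cast_pos.2 (seedCount_pos hu)
    rw [nodeShare, nodeShare, if_pos hu, if_pos (hj ▸ hu)]
    gcongr
  · rw [nodeShare, nodeShare, if_neg hu, if_neg (hj ▸ hu)]
    split_ifs
    · rfl
    · omega
    · exact hε
    · rfl

/-- Fixing a player `i` and the strategies of the other players (via `Function.update s i ·`),
the function `s_i ↦ g^i_v(s_i, s_{-i})` is monotone nondecreasing. -/
theorem gPart_monotone (m n : ℕ) (hm : 2 ≤ m) (hn : 1 ≤ n)
    (c : Fin n → Fin n → ℝ) (hc : ∀ u v, 0 ≤ c u v)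
    (hcsum : ∀ v : Fin n, ∑ u : Fin n, c u v = 1)
    (ε : ℝ) (hε : 0 < ε) (hε' : ε < 1 / (m : ℝ))
    (i : Fin m) (s : Fin m → Finset (Fin n)) (v : Fin n)
    (X Y : Finset (Fin n)) (hXY : X ⊆ Y) :
    gPart c ε (Function.update s i X) i v ≤ gPart c ε (Function.update s i Y) i v := by
  set sX := Function.update s i X with hsX
  set sY := Function.update s i Y with hsY
  have hi : sX i ⊆ sY i := by simpa [hsX, hsY] using hXY
  have hne : ∀ j, j ≠ i → sX j = sY j := fun j hj => by simp [hsX, hsY, hj]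
  have hsub : ∀ j, sX j ⊆ sY j := fun j => by
    rcases eq_or_ne j i with rfl | hj
    · exact hi
    · exact (hne j hj).subset
  have hε1 : ε ≤ 1 :=
    hε'.le.trans (div_le_one_of_le₀ (by exact_mod_cast (by omega : 1 ≤ m)) (Nat.cast_nonneg m))
  have hown : fPart c ε sX i v ≤ fPart c ε sY i v := by
    simp only [fPart_eq_sum_nodeShare]
    exact Finset.sum_le_sum fun u _ =>
      mul_le_mul_of_nonneg_left (nodeShare_le_of_subset hε1 hi hne u) (hc u v)
  have hothers : ∑ j ∈ Finset.univ.erase i, fPart c ε sY j v ≤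
      ∑ j ∈ Finset.univ.erase i, fPart c ε sX j v := by
    refine Finset.sum_le_sum fun j hj => ?_
    simp only [fPart_eq_sum_nodeShare]
    exact Finset.sum_le_sum fun u _ => mul_le_mul_of_nonneg_left
      (nodeShare_le_of_eq_of_subset hε.le (hne j (Finset.ne_of_mem_erase hj)) hsub u) (hc u v)
  have hv : 0 < ∑ u, c u v := by simp [hcsum v]
  have hsplit : ∀ t : Fin m → Finset (Fin n),
      fTot c ε t v = fPart c ε t i v + ∑ j ∈ Finset.univ.erase i, fPart c ε t j v :=
    fun t => (Finset.add_sum_erase _ _ (Finset.mem_univ i)).symm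
  rw [gPart, gPart, div_le_div_iff₀ (fTot_pos hc hε sX i hv) (fTot_pos hc hε sY i hv),
    hsplit sX, hsplit sY, mul_add, mul_add, mul_comm (fPart c ε sY i v) (fPart c ε sX i v)]
  gcongr
  · exact Finset.sum_nonneg fun j _ => fPart_nonneg hc hε.le sY j v
  · exact fPart_nonneg hc hε.le sY i v
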